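/- Let m_X, m_Y, Ω_X, Ω_Y, α, γ̄ > 0 be real numbers with m_XΩ_Y < m_YΩ_X, let C_α = [Γ(m_X)/(Γ(m_X + 2/α) · ₂F₁(m_Y, −2/α; m_X; −m_XΩ_Y/(m_YΩ_X)))]^{α/2}, and let f be the α-Beaulieu-Xie shadowed SNR probability density with normalizing constant C_α. Then the mean instantaneous SNR equals the average SNR: ∫₀^∞ γ · f(γ) dγ = γ̄. -/

import Mathlib

open Real MeasureTheory Set

/-- Pochhammer symbol `(q)_n = q (q+1) ⋯ (q+n-1)`, with `(q)_0 = 1`. -/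
noncomputable def poch (q : ℝ) (n : ℕ) : ℝ := ∏ i ∈ Finset.range n, (q + i)

/-- Confluent (Kummer) hypergeometric function `₁F₁(a; b; z)`. -/
noncomputable def oneF1 (a b z : ℝ) : ℝ :=
  ∑' n : ℕ, (poch a n / poch b n) * z ^ n / (n.factorial : ℝ)

/-- Gauss hypergeometric function `₂F₁(a, b; c; z)`. -/
noncomputable def twoF1 (a b c z : ℝ) : ℝ :=
  ∑' n : ℕ, (poch a n * poch b n / poch c n) * z ^ n / (n.factorial : ℝ)

/-- Confluent Appell (Humbert) function `Φ₂(b₁, b₂; c; x, y)`. -/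
noncomputable def Phi2 (b₁ b₂ c x y : ℝ) : ℝ :=
  ∑' p : ℕ × ℕ, (poch b₁ p.1 * poch b₂ p.2 / poch c (p.1 + p.2)) *
    x ^ p.1 * y ^ p.2 / ((p.1.factorial : ℝ) * (p.2.factorial : ℝ))

/-- The α-Beaulieu-Xie shadowed SNR probability density with parameters
`mX, mY, ΩX, ΩY, α`, average SNR `γbar` and normalizing constant `C`, where
`θ = mY ΩX / (mY ΩX + mX ΩY)` and `δ = mX ΩY / (mY ΩX + mX ΩY)`. -/
noncomputable def aBXpdf (mX mY ΩX ΩY α γbar C γ : ℝ) : ℝ :=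
  (α * (mY * ΩX / (mY * ΩX + mX * ΩY)) ^ mY / (2 * C ^ mX * Real.Gamma mX * γbar)) *
    (γ / γbar) ^ (α * mX / 2 - 1) * Real.exp (-(1 / C) * (γ / γbar) ^ (α / 2)) *
    oneF1 mY mX ((mX * ΩY / (mY * ΩX + mX * ΩY)) / C * (γ / γbar) ^ (α / 2))

lemma poch_zero (q : ℝ) : poch q 0 = 1 := by simp [poch]

lemma poch_succ (q : ℝ) (n : ℕ) : poch q (n + 1) = poch q n * (q + n) := by
  simp [poch, Finset.prod_range_succ]

lemma poch_add (q : ℝ) (m n : ℕ) : poch q (m + n) = poch q m * poch (q + m) n := by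
  induction n with
  | zero => simp [poch_zero]
  | succ n ih => rw [← add_assoc, poch_succ, ih, poch_succ]; push_cast; ring

lemma poch_succ_left (q : ℝ) (n : ℕ) : poch q (n + 1) = q * poch (q + 1) n := by
  rw [add_comm, poch_add]; simp [poch]

lemma poch_pos {q : ℝ} (hq : 0 < q) (n : ℕ) : 0 < poch q n :=
  Finset.prod_pos fun _ _ => by positivity

lemma abs_poch_neg_le {q : ℝ} (hq : 0 < q) (n : ℕ) : |poch (-q) n| ≤ poch q n := by
  unfold poch
  rw [Finset.abs_prod]
  refine Finset.prod_le_prod (fun _ _ => abs_nonneg _) fun i _ => ?_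
  have : (0 : ℝ) ≤ i := i.cast_nonneg
  rw [abs_le]
  constructor <;> linarith

lemma Gamma_add_natCast_eq_poch_mul {q : ℝ} (hq : 0 < q) (n : ℕ) :
    Real.Gamma (q + n) = poch q n * Real.Gamma q := by
  induction n with
  | zero => simp [poch_zero]
  | succ n ih =>
    push_cast
    rw [← add_assoc, Real.Gamma_add_one (by positivity), ih, poch_succ]
    ring

lemma poch_eq_ascPochhammer (q : ℝ) (n : ℕ) : poch q n = (ascPochhammer ℕ n).smeval q := by
  rw [Polynomial.ascPochhammer_smeval_eq_eval]
  induction n with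
  | zero => simp [poch_zero]
  | succ n ih => rw [poch_succ, ih, ascPochhammer_succ_eval]

/-- The binomial series in terms of Pochhammer symbols. -/
lemma hasSum_poch_div_factorial_mul_pow (b : ℝ) {x : ℝ} (hx : |x| < 1) :
    HasSum (fun n : ℕ => poch b n / (n.factorial : ℝ) * x ^ n) ((1 - x) ^ (-b)) := by
  have h := (Real.one_div_one_sub_rpow_hasFPowerSeriesOnBall_zero b).hasSum (y := x)
    (by simpa [enorm_eq_nnnorm, ← NNReal.coe_lt_one] using hx)
  have h1 : 0 < 1 - x := by linarith [(abs_lt.mp hx).2]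
  rw [Real.rpow_neg h1.le, ← one_div]
  simp only [zero_add] at h
  have hterm (n : ℕ) : poch b n / (n.factorial : ℝ) = Ring.choose (b + n - 1) n := by
    rw [poch_eq_ascPochhammer, ← Ring.factorial_nsmul_multichoose_eq_ascPochhammer,
      Ring.multichoose_eq, nsmul_eq_mul,
      mul_div_cancel_left₀ _ (Nat.cast_ne_zero.mpr n.factorial_ne_zero)]
  simp only [hterm]
  simpa [FormalMultilinearSeries.ofScalars_apply_eq, mul_comm] using h

/-- The Chu–Vandermonde identity. -/
lemma sum_antidiagonal_choose_mul_poch (s c : ℝ) (n : ℕ) :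
    ∑ p ∈ Finset.HasAntidiagonal.antidiagonal n,
      (n.choose p.1 : ℝ) * ((-1) ^ p.1 * poch (-s) p.1 * poch (c + p.1) p.2) = poch (c + s) n := by
  induction n generalizing s c with
  | zero => simp [poch_zero]
  | succ n ih =>
    rw [Finset.sum_antidiagonal_choose_succ_mul
      (fun i j => (-1) ^ i * poch (-s) i * poch (c + i) j)]
    have h1 : ∑ p ∈ Finset.HasAntidiagonal.antidiagonal n,
        (n.choose p.1 : ℝ) * ((-1) ^ p.1 * poch (-s) p.1 * poch (c + p.1) (p.2 + 1)) =
        (c + n) * poch (c + s) n := by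
      rw [← ih s c, Finset.mul_sum]
      refine Finset.sum_congr rfl fun p hp => ?_
      have : (n : ℝ) = p.1 + p.2 := by
        rw [← Finset.HasAntidiagonal.mem_antidiagonal.mp hp]; push_cast; rfl
      rw [poch_succ, this]
      ring
    have h2 : ∑ p ∈ Finset.HasAntidiagonal.antidiagonal n,
        (n.choose p.2 : ℝ) * ((-1) ^ (p.1 + 1) * poch (-s) (p.1 + 1) *
          poch (c + (p.1 + 1 : ℕ)) p.2) = s * poch (c + s) n := by
      rw [show c + s = (c + 1) + (s - 1) by ring, ← ih (s - 1) (c + 1), Finset.mul_sum]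
      refine Finset.sum_congr rfl fun p hp => ?_
      rw [Nat.choose_symm_of_eq_add (Finset.HasAntidiagonal.mem_antidiagonal.mp hp).symm, poch_succ_left]
      push_cast
      rw [show c + ((p.1 : ℝ) + 1) = c + 1 + p.1 by ring, show -(s - 1) = -s + 1 by ring]
      ring
    rw [h1, h2, poch_succ]
    ring

lemma summable_twoF1_terms {a b c w : ℝ} (ha : 0 < a) (hb : 0 < b) (hc : 0 < c) (hw0 : 0 < w)
    (hw1 : w < 1) :
    Summable fun n : ℕ => poch a n * poch b n / poch c n * w ^ n / (n.factorial : ℝ) := by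
  have hlim (d : ℝ) : Filter.Tendsto (fun n : ℕ => (n + d) / (n : ℝ)) Filter.atTop (nhds 1) := by
    have h := (tendsto_const_div_atTop_nhds_zero_nat d).const_add 1
    rw [add_zero] at h
    refine h.congr' ?_
    filter_upwards [Filter.eventually_gt_atTop 0] with n hn
    have : (n : ℝ) ≠ 0 := by positivity
    field_simp
  have hpos (n : ℕ) : 0 < poch a n * poch b n / poch c n * w ^ n / (n.factorial : ℝ) := by
    have := poch_pos ha n
    have := poch_pos hb n
    have := poch_pos hc n
    positivity
  refine summable_of_ratio_test_tendsto_lt_one hw1 (.of_forall fun n => (hpos n).ne') ?_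
  have h := (((hlim a).mul (hlim b)).div ((hlim c).mul (hlim 1)) (by norm_num)).mul_const w
  norm_num at h
  refine h.congr' ?_
  filter_upwards [Filter.eventually_gt_atTop 0] with n hn
  rw [Real.norm_of_nonneg (hpos _).le, Real.norm_of_nonneg (hpos _).le]
  have h1 := poch_pos ha n
  have h2 := poch_pos hb n
  have h3 := poch_pos hc n
  rw [poch_succ, poch_succ, poch_succ, pow_succ, Nat.factorial_succ]
  have hn' : (0 : ℝ) < n := by exact_mod_cast hn
  push_cast
  field_simp
  ring

/-- Pfaff's transformation of the Gauss hypergeometric series. -/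
lemma hasSum_twoF1_pfaff {a c s x : ℝ} (ha : 0 < a) (hc : 0 < c) (hs : 0 < s) (hx0 : 0 < x)
    (hx : x < 1 / 2) :
    HasSum (fun n : ℕ => poch a n * poch (c + s) n / poch c n * x ^ n / (n.factorial : ℝ))
      ((1 - x) ^ (-a) * twoF1 a (-s) c (-(x / (1 - x)))) := by
  have hx1 : 0 < 1 - x := by linarith
  set w := x / (1 - x) with hw
  have hw0 : 0 < w := by positivity
  have hw1 : w < 1 := by rw [hw, div_lt_one hx1]; linarith
  have habs : |x| < 1 := by rw [abs_of_pos hx0]; linarith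
  let A (k : ℕ) : ℝ := poch a k * poch (-s) k / poch c k / (k.factorial : ℝ)
  let F (p : ℕ × ℕ) : ℝ :=
    A p.1 * (-x) ^ p.1 * (poch (a + p.1) p.2 / (p.2.factorial : ℝ) * x ^ p.2)
  have hpow (k : ℕ) : (1 - x) ^ (-(a + k)) = (1 - x) ^ (-a) / (1 - x) ^ k := by
    rw [neg_add, ← sub_eq_add_neg, Real.rpow_sub hx1, Real.rpow_natCast]
  have hrow (k : ℕ) : HasSum (fun j => F (k, j))
      ((1 - x) ^ (-a) * (poch a k * poch (-s) k / poch c k * (-w) ^ k / (k.factorial : ℝ))) := by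
    have h := (hasSum_poch_div_factorial_mul_pow (a + k) habs).mul_left (A k * (-x) ^ k)
    have e : (1 - x) ^ (-a) * (poch a k * poch (-s) k / poch c k * (-w) ^ k / (k.factorial : ℝ)) =
        A k * (-x) ^ k * (1 - x) ^ (-(a + k)) := by
      rw [hpow, hw, ← neg_div, div_pow]
      simp only [A]
      ring
    rw [e]
    exact h
  have hrow_abs (k : ℕ) : HasSum (fun j => |F (k, j)|)
      ((1 - x) ^ (-a) * |poch a k * poch (-s) k / poch c k * (-w) ^ k / (k.factorial : ℝ)|) := by
    have hpos (j : ℕ) : 0 ≤ poch (a + k) j / (j.factorial : ℝ) * x ^ j := by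
      have := poch_pos (show 0 < a + k by positivity) j
      positivity
    have h2 := (hasSum_poch_div_factorial_mul_pow (a + k) habs).mul_left |A k * (-x) ^ k|
    have e : (1 - x) ^ (-a) * |poch a k * poch (-s) k / poch c k * (-w) ^ k / (k.factorial : ℝ)| =
        |A k * (-x) ^ k| * (1 - x) ^ (-(a + k)) := by
      rw [hpow, hw, ← neg_div, div_pow]
      simp only [A, abs_mul, abs_div, abs_pow, abs_of_pos hx1]
      ring
    rw [e]
    have e2 : (fun j => |F (k, j)|) =
        fun j : ℕ => |A k * (-x) ^ k| * (poch (a + k) j / (j.factorial : ℝ) * x ^ j) := by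
      ext j
      simp only [F]
      rw [abs_mul, abs_of_nonneg (hpos j)]
    rw [e2]
    exact h2
  have hsum : Summable F := by
    refine Summable.of_abs ?_
    rw [summable_prod_of_nonneg (fun p => abs_nonneg _)]
    refine ⟨fun k => (hrow_abs k).summable, ?_⟩
    simp only [(hrow_abs _).tsum_eq]
    refine Summable.mul_left _ (Summable.of_nonneg_of_le (fun _ => abs_nonneg _) (fun k => ?_)
      (summable_twoF1_terms ha hs hc hw0 hw1))
    have h1 := poch_pos ha k
    have h3 := poch_pos hc k
    rw [abs_div, abs_mul, abs_div, abs_mul, abs_pow, abs_neg, abs_of_pos h1, abs_of_pos h3,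
      abs_of_pos hw0, Nat.abs_cast]
    have := abs_poch_neg_le hs k
    gcongr
  have htot : HasSum F ((1 - x) ^ (-a) * twoF1 a (-s) c (-w)) := by
    have h := hsum.hasSum
    have h2 := (h.prod_fiberwise hrow).tsum_eq
    rw [tsum_mul_left] at h2
    rw [twoF1, h2]
    exact h
  have hdiag := ((Finset.HasAntidiagonal.sigmaAntidiagonalEquivProd (A := ℕ)).hasSum_iff.2 htot).sigma
    (fun n => hasSum_fintype _)
  have hterm (n : ℕ) : poch a n * poch (c + s) n / poch c n * x ^ n / (n.factorial : ℝ) =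
      ∑ p : Finset.HasAntidiagonal.antidiagonal n, F p := by
    rw [Finset.sum_coe_sort (Finset.HasAntidiagonal.antidiagonal n) F,
      ← sum_antidiagonal_choose_mul_poch, Finset.mul_sum, Finset.sum_div, Finset.sum_mul,
      Finset.sum_div]
    refine Finset.sum_congr rfl fun p hp => ?_
    obtain ⟨k, j⟩ := p
    obtain rfl := Finset.HasAntidiagonal.mem_antidiagonal.mp hp
    have h1 := poch_pos hc k
    have h2 := poch_pos (show 0 < c + k by positivity) j
    simp only [F, A]
    rw [Nat.cast_add_choose, poch_add a, poch_add c, neg_pow x, pow_add]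
    field_simp
  simp only [hterm]
  exact hdiag

lemma integral_mul_oneF1 {a c α C δ S : ℝ} (ha : 0 < a) (hc : 0 < c) (hα : 0 < α) (hC : 0 < C)
    (hδ : 0 < δ)
    (hS : HasSum (fun n : ℕ => poch a n * poch (c + 2 / α) n / poch c n * δ ^ n / (n.factorial : ℝ))
      S) :
    ∫ t in Ioi (0 : ℝ), t * (t ^ (α * c / 2 - 1) * Real.exp (-(1 / C) * t ^ (α / 2)) *
      oneF1 a c (δ / C * t ^ (α / 2))) =
      2 / α * C ^ (c + 2 / α) * Real.Gamma (c + 2 / α) * S := by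
  let K (n : ℕ) : ℝ := poch a n / poch c n * (δ / C) ^ n / (n.factorial : ℝ)
  let G (n : ℕ) (t : ℝ) : ℝ :=
    K n * (t ^ (α * (c + n) / 2) * Real.exp (-(1 / C) * t ^ (α / 2)))
  have hK (n : ℕ) : 0 < K n := by
    have := poch_pos ha n
    have := poch_pos hc n
    positivity
  have hint (n : ℕ) : IntegrableOn (G n) (Ioi 0) :=
    (integrableOn_rpow_mul_exp_neg_mul_rpow
      (by linarith [show 0 < α * (c + n) / 2 by positivity]) (by positivity)
      (by positivity)).const_mul _
  have hval (n : ℕ) : ∫ t in Ioi (0 : ℝ), G n t = 2 / α * C ^ (c + 2 / α) *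
      Real.Gamma (c + 2 / α) *
        (poch a n * poch (c + 2 / α) n / poch c n * δ ^ n / (n.factorial : ℝ)) := by
    simp only [G]
    rw [integral_const_mul, integral_rpow_mul_exp_neg_mul_rpow (by positivity)
      (by linarith [show 0 < α * (c + n) / 2 by positivity]) (by positivity),
      show -(α * (c + n) / 2 + 1) / (α / 2) = -(c + 2 / α + n) by field_simp; ring,
      show (α * (c + n) / 2 + 1) / (α / 2) = c + 2 / α + n by field_simp; ring,
      Gamma_add_natCast_eq_poch_mul (by positivity), one_div C, Real.rpow_neg (by positivity),
      Real.inv_rpow hC.le, inv_inv, Real.rpow_add hC, Real.rpow_natCast]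
    simp only [K, div_pow]
    field_simp
  have hnorm (n : ℕ) : ∫ t in Ioi (0 : ℝ), ‖G n t‖ = ∫ t in Ioi (0 : ℝ), G n t := by
    refine setIntegral_congr_fun measurableSet_Ioi fun t ht => ?_
    have ht : 0 < t := ht
    have := hK n
    exact Real.norm_of_nonneg (by positivity)
  have hsum := hasSum_integral_of_summable_integral_norm hint (by
    simp only [hnorm, hval]
    exact hS.summable.mul_left _)
  simp only [hval] at hsum
  rw [← hsum.unique (hS.mul_left _)]
  refine setIntegral_congr_fun measurableSet_Ioi fun t ht => ?_
  have ht : 0 < t := ht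
  simp only [oneF1]
  rw [← mul_assoc, ← tsum_mul_left]
  refine tsum_congr fun n => ?_
  have hexp : t ^ (α * (c + n) / 2) = t * t ^ (α * c / 2 - 1) * (t ^ (α / 2)) ^ n := by
    rw [← Real.rpow_natCast, ← Real.rpow_mul ht.le, ← Real.rpow_one_add' ht.le, ← Real.rpow_add ht]
    · ring_nf
    · rw [add_sub_cancel]; positivity
  simp only [G, K]
  rw [hexp]
  ring

/-- With the canonical normalizing constant `C_α`, the mean instantaneous SNR
of the α-Beaulieu-Xie shadowed model equals the average SNR `γ̄`. -/
theorem statement_6 (mX mY ΩX ΩY α γbar : ℝ) (hmX : 0 < mX) (hmY : 0 < mY)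
    (hΩX : 0 < ΩX) (hΩY : 0 < ΩY) (hα : 0 < α) (hγbar : 0 < γbar)
    (hshad : mX * ΩY < mY * ΩX) :
    ∫ γ in Set.Ioi (0 : ℝ), γ *
        aBXpdf mX mY ΩX ΩY α γbar
          ((Real.Gamma mX / (Real.Gamma (mX + 2 / α) *
              twoF1 mY (-(2 / α)) mX (-(mX * ΩY / (mY * ΩX))))) ^ (α / 2)) γ
      = γbar := by
  set u := mX * ΩY with hu
  set v := mY * ΩX with hv
  have hu0 : 0 < u := by positivity
  have hv0 : 0 < v := by positivity
  set T := twoF1 mY (-(2 / α)) mX (-(u / v)) with hT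
  set δ := u / (v + u) with hδ
  set θ := v / (v + u) with hθ
  have hδ0 : 0 < δ := by positivity
  have hθ0 : 0 < θ := by positivity
  have hθδ : 1 - δ = θ := by rw [hδ, hθ]; field_simp; ring
  have hδ2 : δ < 1 / 2 := by rw [hδ, div_lt_div_iff₀ (by positivity) two_pos]; linarith
  have hS := hasSum_twoF1_pfaff (s := 2 / α) hmY hmX (by positivity) hδ0 hδ2
  rw [hθδ, show δ / θ = u / v by rw [hδ, hθ]; field_simp, ← hT] at hS
  have hST : 0 < θ ^ (-mY) * T := by
    have hpos (n : ℕ) : 0 < poch mY n * poch (mX + 2 / α) n / poch mX n * δ ^ n /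
        (n.factorial : ℝ) := by
      have := poch_pos hmY n
      have := poch_pos hmX n
      have := poch_pos (show 0 < mX + 2 / α by positivity) n
      positivity
    rw [← hS.tsum_eq]
    exact hS.summable.tsum_pos (fun n => (hpos n).le) 0 (hpos 0)
  have hT0 : 0 < T := pos_of_mul_pos_right hST (by positivity)
  have hΓ : 0 < Real.Gamma mX := Real.Gamma_pos_of_pos hmX
  have hΓ2 : 0 < Real.Gamma (mX + 2 / α) := Real.Gamma_pos_of_pos (by positivity)
  set R := Real.Gamma mX / (Real.Gamma (mX + 2 / α) * T) with hR
  have hR0 : 0 < R := by positivity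
  set C := R ^ (α / 2) with hC
  have hC0 : 0 < C := by positivity
  have hCR : C ^ (2 / α) = R := by
    rw [hC, ← Real.rpow_mul hR0.le, show α / 2 * (2 / α) = 1 by field_simp, Real.rpow_one]
  let H (t : ℝ) : ℝ := t * (t ^ (α * mX / 2 - 1) * Real.exp (-(1 / C) * t ^ (α / 2)) *
      oneF1 mY mX (δ / C * t ^ (α / 2)))
  have hH : ∀ γ, γ * aBXpdf mX mY ΩX ΩY α γbar C γ =
      α * θ ^ mY / (2 * C ^ mX * Real.Gamma mX) * H (γbar⁻¹ * γ) := by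
    intro γ
    simp only [aBXpdf, H, ← hu, ← hv, ← hδ, ← hθ]
    rw [show γbar⁻¹ * γ = γ / γbar by ring]
    field_simp
  simp only [hH]
  rw [integral_const_mul, integral_comp_mul_left_Ioi H 0 (inv_pos.mpr hγbar), mul_zero, inv_inv,
    smul_eq_mul, integral_mul_oneF1 hmY hmX hα hC0 hδ0 hS, Real.rpow_add hC0, hCR, hR,
    Real.rpow_neg hθ0.le]
  field_simp
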